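/- arXiv:2407.07644 — 3 statements merged into one kernel-verified Lean document; each statement's English description precedes it below -/
import Mathlib

section
/- For every prime number p and every positive integer d, we have n(Z_p^d) ≤ 5d·f(p,d). Concretely: for every labelling of the arcs of the complete digraph on 5d·f(p,d) vertices by elements of the group (Z_p)^d, there exists a directed cycle whose arc-labels sum to zero. -/
/-- A multiset `B` of elements of `(ℤ_p)^d` is an *additive basis* if every element of
`(ℤ_p)^d` can be written as the sum of the elements of a (possibly empty) sub-multiset of `B`. -/
def IsAdditiveBasis (p d : ℕ) (B : Multiset (Fin d → ZMod p)) : Prop :=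
  ∀ x : Fin d → ZMod p, ∃ S : Multiset (Fin d → ZMod p), S ≤ B ∧ S.sum = x

/-- The property that the multiset union of any `m` linear bases of `(ℤ_p)^d` over `F_p`
forms an additive basis of `(ℤ_p)^d`. -/
def AdditiveBasisProp (p d m : ℕ) : Prop :=
  ∀ b : Fin m → Fin d → (Fin d → ZMod p),
    (∀ i, LinearIndependent (ZMod p) (b i)) →
    (∀ i, Submodule.span (ZMod p) (Set.range (b i)) = ⊤) →
    IsAdditiveBasis p d
      ((Finset.univ.val : Multiset (Fin m)).bind fun i =>
        Multiset.map (b i) (Finset.univ.val : Multiset (Fin d)))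

/-- `f p d` is the smallest positive integer `m` such that the multiset union of any `m`
linear bases of `(ℤ_p)^d` is an additive basis of `(ℤ_p)^d`. -/
noncomputable def f (p d : ℕ) : ℕ := sInf {m | 0 < m ∧ AdditiveBasisProp p d m}

/-- A labelling `w` of the arcs of the complete digraph on `n` vertices by elements of an
abelian group `Γ` admits a zero-sum directed cycle: there are `ℓ + 2 ≥ 2` distinct vertices
`v 0, …, v (ℓ+1)` with `∑ i, w (v i) (v (i+1)) = 0` (indices mod `ℓ + 2`). -/
def HasZeroSumCycle {Γ : Type*} [AddCommGroup Γ] {n : ℕ} (w : Fin n → Fin n → Γ) : Prop :=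
  ∃ (ℓ : ℕ) (v : Fin (ℓ + 2) → Fin n), Function.Injective v ∧
    ∑ i : Fin (ℓ + 2), w (v i) (v (i + 1)) = 0

open Module in
/-- **Rado's theorem** for linear independence: a finite family of finite sets of vectors has a
linearly independent transversal if the union of any `k` of them spans dimension at least `k`. -/
theorem exists_linearIndependent_transversal {F W ι : Type*} [Field F] [AddCommGroup W]
    [Module F W] [Module.Finite F W] [Fintype ι] (A : ι → Finset W)
    (h : ∀ J : Finset ι, J.card ≤ finrank F (Submodule.span F (⋃ i ∈ J, (A i : Set W)))) :
    ∃ x : ι → W, (∀ i, x i ∈ A i) ∧ LinearIndependent F x := by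
  classical
  induction hn : ∑ i, (A i).card using Nat.strong_induction_on generalizing A with
  | _ n ih =>
  by_cases hc : ∀ i, (A i).card ≤ 1
  · have hne : ∀ i, ∃ x, A i = {x} := by
      intro i
      rw [← Finset.card_eq_one]
      refine le_antisymm (hc i) (Finset.card_pos.2 ?_)
      by_contra hemp
      rw [Finset.not_nonempty_iff_eq_empty] at hemp
      simpa [hemp] using h {i}
    choose x hx using hne
    refine ⟨x, by simp [hx], ?_⟩
    rw [linearIndependent_iff_card_le_finrank_span]
    have := h Finset.univ
    have hU : (⋃ i ∈ (Finset.univ : Finset ι), (A i : Set W)) = Set.range x := by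
      ext y
      simp [hx, eq_comm]
    rwa [hU] at this
  · push Not at hc
    obtain ⟨i₀, hi₀⟩ := hc
    obtain ⟨x, hx, y, hy, hxy⟩ := Finset.one_lt_card.1 hi₀
    have key : ∀ z ∈ A i₀, (∀ J : Finset ι, J.card ≤ finrank F (Submodule.span F
        (⋃ i ∈ J, (Function.update A i₀ ((A i₀).erase z) i : Set W)))) →
        ∃ x : ι → W, (∀ i, x i ∈ A i) ∧ LinearIndependent F x := by
      intro z hz hJ
      obtain ⟨u, hu, hli⟩ := ih (∑ i, (Function.update A i₀ ((A i₀).erase z) i).card) (by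
        rw [← hn]
        refine Finset.sum_lt_sum (fun i _ => ?_) ⟨i₀, Finset.mem_univ _, ?_⟩
        · by_cases hi : i = i₀
          · subst hi; simpa using Finset.card_erase_le
          · simp [hi]
        · simpa using Finset.card_erase_lt_of_mem hz) _ hJ rfl
      refine ⟨u, fun i => ?_, hli⟩
      have := hu i
      by_cases hi : i = i₀
      · subst hi
        simp only [Function.update_self] at this
        exact Finset.mem_of_mem_erase this
      · simpa [hi] using this
    by_contra hcon
    have hX := mt (key x hx) hcon
    have hY := mt (key y hy) hcon
    push Not at hX hY
    obtain ⟨J, hJ⟩ := hX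
    obtain ⟨J', hJ'⟩ := hY
    have hmem : ∀ (z : W) (J : Finset ι), finrank F (Submodule.span F
        (⋃ i ∈ J, (Function.update A i₀ ((A i₀).erase z) i : Set W))) < J.card → i₀ ∈ J := by
      intro z J hJ
      by_contra hi
      refine absurd (h J) (not_le.2 ?_)
      have hU : (⋃ i ∈ J, (Function.update A i₀ ((A i₀).erase z) i : Set W)) =
          ⋃ i ∈ J, (A i : Set W) :=
        Set.iUnion₂_congr fun i hi' => by
          rw [Function.update_of_ne]
          rintro rfl
          exact hi hi'
      rwa [hU] at hJ
    have hJm := hmem _ _ hJ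
    have hJm' := hmem _ _ hJ'
    set P := Submodule.span F
        (⋃ i ∈ J, (Function.update A i₀ ((A i₀).erase x) i : Set W)) with hP
    set Q := Submodule.span F
        (⋃ i ∈ J', (Function.update A i₀ ((A i₀).erase y) i : Set W)) with hQ
    have hPm : ∀ i ∈ J, ∀ u ∈ A i, (i = i₀ → u ≠ x) → u ∈ P := by
      intro i hi u hu hne
      refine Submodule.subset_span (Set.mem_iUnion₂.2 ⟨i, hi, ?_⟩)
      by_cases hii : i = i₀
      · subst hii; simpa using ⟨hu, hne rfl⟩
      · simpa [hii] using hu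
    have hQm : ∀ i ∈ J', ∀ u ∈ A i, (i = i₀ → u ≠ y) → u ∈ Q := by
      intro i hi u hu hne
      refine Submodule.subset_span (Set.mem_iUnion₂.2 ⟨i, hi, ?_⟩)
      by_cases hii : i = i₀
      · subst hii; simpa using ⟨hu, hne rfl⟩
      · simpa [hii] using hu
    have hsup : Submodule.span F (⋃ i ∈ J ∪ J', (A i : Set W)) ≤ P ⊔ Q := by
      rw [Submodule.span_le]
      intro u hu
      obtain ⟨i, hi, hu⟩ := Set.mem_iUnion₂.1 hu
      by_cases hii : i = i₀
      · subst hii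
        by_cases hux : u = x
        · exact Submodule.mem_sup_right (hQm _ hJm' u hu fun _ => hux ▸ hxy)
        · exact Submodule.mem_sup_left (hPm _ hJm u hu fun _ => hux)
      · rcases Finset.mem_union.1 hi with hi | hi
        · exact Submodule.mem_sup_left (hPm _ hi u hu fun h => absurd h hii)
        · exact Submodule.mem_sup_right (hQm _ hi u hu fun h => absurd h hii)
    have hinf : Submodule.span F (⋃ i ∈ (J ∩ J').erase i₀, (A i : Set W)) ≤ P ⊓ Q := by
      rw [Submodule.span_le]
      intro u hu
      obtain ⟨i, hi, hu⟩ := Set.mem_iUnion₂.1 hu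
      simp only [Finset.mem_erase, Finset.mem_inter] at hi
      exact ⟨hPm _ hi.2.1 u hu fun h => absurd h hi.1, hQm _ hi.2.2 u hu fun h => absurd h hi.1⟩
    have h1 := (h _).trans (Submodule.finrank_mono hsup)
    have h2 := (h _).trans (Submodule.finrank_mono hinf)
    have h3 := Submodule.finrank_sup_add_finrank_inf_eq P Q
    have h4 := Finset.card_union_add_card_inter J J'
    rw [Finset.card_erase_of_mem (Finset.mem_inter.2 ⟨hJm, hJm'⟩)] at h2
    omega

open Module in
/-- **Edmonds' partition theorem** for vectors (Rado–Horn): a finite family of vectors with at most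
`m * dim L` members in every subspace `L` can be split into `m` linearly independent families. -/
theorem exists_coloring_linearIndependent {F E ι : Type*} [Field F] [AddCommGroup E] [Module F E]
    [Module.Finite F E] [Fintype ι] (v : ι → E) (m : ℕ)
    (h : ∀ (L : Submodule F E) (J : Finset ι), (∀ i ∈ J, v i ∈ L) → J.card ≤ m * finrank F L) :
    ∃ c : ι → Fin m, ∀ j, LinearIndependent F fun i : {i // c i = j} => v i := by
  classical
  obtain ⟨x, hx, hli⟩ := exists_linearIndependent_transversal (F := F) (W := Fin m → E)
    (fun i : ι => Finset.univ.image fun j : Fin m => (Pi.single j (v i) : Fin m → E)) (by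
      intro J
      set L := Submodule.span F (v '' J) with hL
      refine (h L J fun i hi => Submodule.subset_span ⟨i, hi, rfl⟩).trans ?_
      let φ : (Fin m → L) →ₗ[F] (Fin m → E) := L.subtype.compLeft (Fin m)
      have hφ : Function.Injective φ := by
        intro a b hab
        funext j
        exact Subtype.ext (congrFun hab j)
      have hr : LinearMap.range φ ≤ Submodule.span F (⋃ i ∈ J, ((Finset.univ.image
          fun j : Fin m => (Pi.single j (v i) : Fin m → E) : Finset _) : Set (Fin m → E))) := by
        rintro _ ⟨a, rfl⟩
        have : φ a = ∑ j, Pi.single j (a j : E) := by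
          rw [Finset.univ_sum_single]
          rfl
        rw [this]
        refine Submodule.sum_mem _ fun j _ => ?_
        have hle : L ≤ (Submodule.span F (⋃ i ∈ J, ((Finset.univ.image
          fun j : Fin m => (Pi.single j (v i) : Fin m → E) : Finset _) :
            Set (Fin m → E)))).comap (LinearMap.single F (fun _ => E) j) := by
          rw [hL, Submodule.span_le]
          rintro _ ⟨i, hi, rfl⟩
          refine Submodule.subset_span (Set.mem_iUnion₂.2 ⟨i, hi, ?_⟩)
          simp
        exact hle (a j).2
      calc m * finrank F L = finrank F (Fin m → L) := by simp [Module.finrank_pi_fintype]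
        _ = finrank F (LinearMap.range φ) := (LinearMap.finrank_range_of_inj hφ).symm
        _ ≤ _ := Submodule.finrank_mono hr)
  have : ∀ i, ∃ j, Pi.single j (v i) = x i := by simpa using hx
  choose c hc using this
  refine ⟨c, fun j => ?_⟩
  have h1 := hli.comp (fun i : {i // c i = j} => (i : ι)) Subtype.val_injective
  refine LinearIndependent.of_comp (LinearMap.single F (fun _ : Fin m => E) j) ?_
  have h2 : (x ∘ fun i : {i // c i = j} => (i : ι)) =
      LinearMap.single F (fun _ : Fin m => E) j ∘ fun i : {i // c i = j} => v i := by
    funext i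
    simp [← hc, i.2]
  exact h2 ▸ h1

theorem exists_le_map_eq_of_le_map {α β : Type*} (g : α → β) {s : Multiset α} {S : Multiset β}
    (h : S ≤ s.map g) : ∃ T ≤ s, T.map g = S := by
  induction s using Multiset.induction_on generalizing S with
  | empty => exact ⟨0, le_rfl, by simpa [eq_comm] using h⟩
  | cons a s ih =>
    rw [Multiset.map_cons] at h
    by_cases ha : g a ∈ S
    · obtain ⟨S', rfl⟩ := Multiset.exists_cons_of_mem ha
      obtain ⟨T, hT, rfl⟩ := ih ((Multiset.cons_le_cons_iff _).1 h)
      exact ⟨a ::ₘ T, Multiset.cons_le_cons _ hT, by simp⟩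
    · obtain ⟨T, hT, rfl⟩ := ih ((Multiset.le_cons_of_notMem ha).1 h)
      exact ⟨T, hT.trans (Multiset.le_cons_self _ _), rfl⟩

theorem isAdditiveBasis_bind_iff {p d m : ℕ} (b : Fin m → Fin d → (Fin d → ZMod p)) :
    IsAdditiveBasis p d ((Finset.univ.val : Multiset (Fin m)).bind fun i =>
        Multiset.map (b i) (Finset.univ.val : Multiset (Fin d))) ↔
      ∀ x, ∃ T : Finset (Fin m × Fin d), ∑ t ∈ T, b t.1 t.2 = x := by
  have hB : ((Finset.univ.val : Multiset (Fin m)).bind fun i =>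
        Multiset.map (b i) (Finset.univ.val : Multiset (Fin d))) =
      (Finset.univ : Finset (Fin m × Fin d)).val.map fun t => b t.1 t.2 := by
    rw [← Finset.univ_product_univ, Finset.product_val]
    simp only [SProd.sprod, Multiset.product, Multiset.map_bind, Multiset.map_map,
      Function.comp_def]
  rw [hB]
  refine forall_congr' fun x => ⟨?_, ?_⟩
  · rintro ⟨S, hS, rfl⟩
    obtain ⟨T, hT, rfl⟩ := exists_le_map_eq_of_le_map _ hS
    exact ⟨⟨T, Multiset.nodup_of_le hT Finset.univ.nodup⟩, rfl⟩
  · rintro ⟨T, rfl⟩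
    exact ⟨T.val.map fun t => b t.1 t.2,
      Multiset.map_le_map (Finset.val_le_iff.2 (Finset.subset_univ T)), rfl⟩

theorem exists_additiveBasisProp {p : ℕ} (hp : p.Prime) (d : ℕ) :
    ∃ m, 0 < m ∧ AdditiveBasisProp p d m := by
  classical
  have := Fact.mk hp
  refine ⟨Fintype.card (Fin d → (Fin d → ZMod p)) * p,
    Nat.mul_pos Fintype.card_pos hp.pos, fun b hli hsp => ?_⟩
  rw [isAdditiveBasis_bind_iff]
  intro x
  obtain ⟨y, hy⟩ := Fintype.exists_le_card_fiber_of_mul_le_card b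
    (n := p) (by rw [Fintype.card_fin])
  obtain ⟨i₀, hi₀⟩ : ∃ i, b i = y := by
    obtain ⟨i, hi⟩ := Finset.card_pos.1 (hp.pos.trans_le hy)
    exact ⟨i, (Finset.mem_filter.1 hi).2⟩
  have hx : x ∈ Submodule.span (ZMod p) (Set.range y) := by rw [← hi₀, hsp]; trivial
  obtain ⟨a, rfl⟩ := (Submodule.mem_span_range_iff_exists_fun _).1 hx
  have hs : ∀ k, ∃ s ⊆ Finset.univ.filter fun i => b i = y, s.card = (a k).val := fun k =>
    Finset.exists_subset_card_eq ((ZMod.val_lt (a k)).le.trans hy)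
  choose s hs hcard using hs
  refine ⟨Finset.univ.filter fun t => t.1 ∈ s t.2, ?_⟩
  rw [Finset.sum_filter, Fintype.sum_prod_type_right]
  refine Finset.sum_congr rfl fun k _ => ?_
  dsimp only
  rw [← Finset.sum_filter, Finset.filter_mem_eq_inter, Finset.univ_inter,
    Finset.sum_congr rfl (g := fun _ => y k), Finset.sum_const, hcard,
    ← Nat.cast_smul_eq_nsmul (ZMod p), ZMod.natCast_zmod_val]
  intro i hi
  rw [(Finset.mem_filter.1 (hs k hi)).2]

theorem f_pos {p : ℕ} (hp : p.Prime) (d : ℕ) : 0 < f p d :=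
  (Nat.sInf_mem (s := {m | 0 < m ∧ AdditiveBasisProp p d m}) (exists_additiveBasisProp hp d)).1

theorem additiveBasisProp_f {p : ℕ} (hp : p.Prime) (d : ℕ) : AdditiveBasisProp p d (f p d) :=
  (Nat.sInf_mem (s := {m | 0 < m ∧ AdditiveBasisProp p d m}) (exists_additiveBasisProp hp d)).2

open Module in
/-- If `m * dim K` vectors of a subspace `K` satisfy the Rado–Horn condition, then their subset
sums cover `K` as soon as unions of `m` bases of the whole space are additive bases. -/
theorem exists_subset_sum_eq_of_tight {p d m : ℕ} [Fact p.Prime] (hm : AdditiveBasisProp p d m)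
    {ι : Type*} [Fintype ι] (v : ι → (Fin d → ZMod p))
    (h : ∀ (L : Submodule (ZMod p) (Fin d → ZMod p)) (J : Finset ι), (∀ i ∈ J, v i ∈ L) →
      J.card ≤ m * finrank (ZMod p) L)
    (K : Submodule (ZMod p) (Fin d → ZMod p)) (hK : ∀ i, v i ∈ K)
    (hcard : Fintype.card ι = m * finrank (ZMod p) K) (x : Fin d → ZMod p) (hx : x ∈ K) :
    ∃ T : Finset ι, ∑ i ∈ T, v i = x := by
  classical
  obtain ⟨c, hc⟩ := exists_coloring_linearIndependent v m h
  have hle : ∀ j, Fintype.card {i // c i = j} ≤ finrank (ZMod p) K := fun j => by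
    have h1 : LinearIndependent (ZMod p) fun i : {i // c i = j} => (⟨v i, hK i⟩ : K) :=
      LinearIndependent.of_comp K.subtype (hc j)
    exact h1.fintype_card_le_finrank
  have heq : ∀ j, Fintype.card {i // c i = j} = finrank (ZMod p) K := by
    have hsum : ∑ j, Fintype.card {i // c i = j} = ∑ _j : Fin m, finrank (ZMod p) K := by
      rw [← Fintype.card_sigma, Fintype.card_congr (Equiv.sigmaFiberEquiv c), hcard]
      simp
    have := (Finset.sum_eq_sum_iff_of_le fun j _ => hle j).1 hsum
    exact fun j => this j (Finset.mem_univ _)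
  obtain ⟨C, hC⟩ := K.exists_isCompl
  have hdim := Submodule.finrank_add_eq_of_isCompl hC
  rw [Module.finrank_fin_fun] at hdim
  have hcd : ∀ j, Fintype.card (Fin d) =
      Fintype.card ({i // c i = j} ⊕ Fin (finrank (ZMod p) C)) := fun j => by
    rw [Fintype.card_sum, heq]; simp [hdim]
  let e := fun j => Fintype.equivOfCardEq (hcd j)
  let g : (j : Fin m) → {i // c i = j} ⊕ Fin (finrank (ZMod p) C) → (Fin d → ZMod p) := fun j =>
    Sum.elim (fun i => v i) fun k => (finBasis (ZMod p) C k : Fin d → ZMod p)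
  have hli : ∀ j, LinearIndependent (ZMod p) (g j) := by
    intro j
    refine LinearIndependent.sum_type (hc j)
      ((finBasis (ZMod p) C).linearIndependent.map' C.subtype C.ker_subtype) ?_
    refine hC.disjoint.mono ?_ ?_
    · rw [Submodule.span_le]
      rintro _ ⟨i, rfl⟩
      exact hK i
    · rw [Submodule.span_le]
      rintro _ ⟨k, rfl⟩
      exact (finBasis (ZMod p) C k).2
  have hli' : ∀ j, LinearIndependent (ZMod p) (g j ∘ e j) := fun j =>
    (hli j).comp _ (e j).injective
  have hadd := hm (fun j => g j ∘ e j) hli' fun j =>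
    (hli' j).span_eq_top_of_card_eq_finrank' (by simp)
  rw [isAdditiveBasis_bind_iff] at hadd
  obtain ⟨T, hT⟩ := hadd x
  let P := K.projection C hC
  have hPv : ∀ i, P (v i) = v i := fun i => Submodule.projection_apply_of_mem_left hC (hK i)
  refine ⟨Finset.univ.filter fun i => (c i, (e (c i)).symm (Sum.inl ⟨i, rfl⟩)) ∈ T, ?_⟩
  have hPx : P x = x := Submodule.projection_apply_of_mem_left hC hx
  have hterm : ∀ j, ∑ k, (if (j, k) ∈ T then P (g j (e j k)) else 0) =
      ∑ i : {i // c i = j}, if (j, (e j).symm (Sum.inl i)) ∈ T then v i else 0 := by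
    intro j
    rw [← (e j).symm.sum_comp, Fintype.sum_sum_type]
    have h0 : ∀ k, P (g j (Sum.inr k)) = 0 := fun k =>
      Submodule.projection_apply_eq_zero_iff hC |>.2 (finBasis (ZMod p) C k).2
    simp only [Equiv.apply_symm_apply, h0, ite_self, Finset.sum_const_zero, add_zero]
    exact Finset.sum_congr rfl fun i _ => by simp [g, hPv]
  calc _ = ∑ i, if (c i, (e (c i)).symm (Sum.inl ⟨i, rfl⟩)) ∈ T then v i else 0 := by
        rw [Finset.sum_filter]
    _ = ∑ j, ∑ i : {i // c i = j}, if (j, (e j).symm (Sum.inl i)) ∈ T then v i else 0 := by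
        rw [← (Equiv.sigmaFiberEquiv c).sum_comp, Fintype.sum_sigma]
        refine Finset.sum_congr rfl fun j _ => Finset.sum_congr rfl ?_
        rintro ⟨i, rfl⟩ _
        rfl
    _ = ∑ j, ∑ k, if (j, k) ∈ T then P (g j (e j k)) else 0 := by simp_rw [hterm]
    _ = P (∑ t ∈ T, (g t.1 ∘ e t.1) t.2) := by
        rw [map_sum, ← Fintype.sum_prod_type', ← Finset.sum_filter]
        simp
    _ = x := by rw [hT, hPx]

/-- The total label of the walk that starts at `a`, visits the vertices of the list, and ends
at `x`. -/
def walkWeight {V Γ : Type*} [AddCommGroup Γ] (w : V → V → Γ) (x : V) : V → List V → Γ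
  | a, [] => w a x
  | a, b :: l => w a b + walkWeight w x b l

theorem walkWeight_ofFn {V Γ : Type*} [AddCommGroup Γ] (w : V → V → Γ) (x : V) (ℓ : ℕ)
    (v : Fin (ℓ + 1) → V) :
    walkWeight w x (v 0) (List.ofFn fun i : Fin ℓ => v i.succ) =
      ∑ i : Fin ℓ, w (v i.castSucc) (v i.succ) + w (v (Fin.last ℓ)) x := by
  induction ℓ with
  | zero => simp [walkWeight]
  | succ ℓ ih =>
    rw [List.ofFn_succ, walkWeight, ih fun i => v i.succ, Fin.sum_univ_succ, ← add_assoc]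
    simp

theorem hasZeroSumCycle_of_walkWeight {Γ : Type*} [AddCommGroup Γ] {n : ℕ}
    (w : Fin n → Fin n → Γ) {a : Fin n} {l : List (Fin n)} (hl : l ≠ []) (hnd : (a :: l).Nodup)
    (hw : walkWeight w a a l = 0) : HasZeroSumCycle w := by
  obtain ⟨b, l, rfl⟩ := List.exists_cons_of_ne_nil hl
  refine ⟨l.length, (a :: b :: l).get, List.nodup_iff_injective_get.1 hnd, ?_⟩
  have h := walkWeight_ofFn w a (l.length + 1) (a :: b :: l).get
  have hofn : (List.ofFn fun i : Fin (l.length + 1) => (a :: b :: l).get i.succ) = b :: l :=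
    List.ofFn_get (b :: l)
  rw [hofn] at h
  rw [Fin.sum_univ_castSucc]
  simp only [Fin.coeSucc_eq_succ, Fin.last_add_one]
  exact h.symm.trans hw

/-- The vertices of a triple. -/
def tripleSupport {V : Type*} [DecidableEq V] (t : V × V × V) : Finset V :=
  {t.1, t.2.1, t.2.2}

/-- The three vertices of the triple are distinct. -/
def TripleDistinct {V : Type*} (t : V × V × V) : Prop :=
  t.1 ≠ t.2.1 ∧ t.2.1 ≠ t.2.2 ∧ t.1 ≠ t.2.2

/-- The change of weight when the arc `(a, b)` is replaced with the path `a, z, b`, for a triple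
`(a, z, b)`. -/
def detour {V Γ : Type*} [AddCommGroup Γ] (w : V → V → Γ) (t : V × V × V) : Γ :=
  w t.1 t.2.1 + w t.2.1 t.2.2 - w t.1 t.2.2

section Cycle

variable {V Γ : Type*} [DecidableEq V] [AddCommGroup Γ]

theorem exists_walks (w : V → V → Γ) (K : AddSubgroup Γ) (π : V → Γ) (R : Finset V)
    (hR : ∀ r ∈ R, ∀ r' ∈ R, r ≠ r' → w r r' - (π r' - π r) ∈ K) {x : V} (hx : x ∈ R)
    (gs : List (V × V × V))
    (hdisj : gs.Pairwise fun s t => Disjoint (tripleSupport s) (tripleSupport t))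
    (hgR : ∀ g ∈ gs, Disjoint (tripleSupport g) R) (hdist : ∀ g ∈ gs, TripleDistinct g)
    (hg : ∀ g ∈ gs, ∀ r ∈ R, ∀ r' ∈ R, r ≠ r' →
      w r g.1 + w g.1 g.2.2 + w g.2.2 r' - (π r' - π r) ∈ K)
    {r₀ : V} (hr₀ : r₀ ∈ R) (R' : Finset V) (hR' : R' ⊆ R) (hr₀' : r₀ ∉ R') (hx' : x ∉ R')
    (hlen : gs.length ≤ R'.card) (hne : gs = [] → r₀ ≠ x) :
    ∃ c, c - (π x - π r₀) ∈ K ∧ ∀ T : Finset (V × V × V), ∃ l : List V, (r₀ :: l).Nodup ∧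
      (gs ≠ [] → l ≠ []) ∧ (∀ y ∈ l, y ∈ R' ∨ ∃ g ∈ gs, y ∈ tripleSupport g) ∧
      walkWeight w x r₀ l = c + ((gs.filter (· ∈ T)).map (detour w)).sum := by
  induction gs generalizing r₀ R' with
  | nil => exact ⟨w r₀ x, hR _ hr₀ _ hx (hne rfl), fun T => ⟨[], by simp [walkWeight]⟩⟩
  | cons g gs ih =>
    obtain ⟨r₁, hr₁⟩ : R'.Nonempty := Finset.card_pos.1 (by simp at hlen; omega)
    rw [List.pairwise_cons] at hdisj
    have hr₁x : r₁ ≠ x := fun h => hx' (h ▸ hr₁)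
    have hr₀₁ : r₀ ≠ r₁ := fun h => hr₀' (h ▸ hr₁)
    obtain ⟨c, hc, hT⟩ := ih hdisj.2 (fun g h => hgR g (List.mem_cons_of_mem _ h))
      (fun g h => hdist g (List.mem_cons_of_mem _ h)) (fun g h => hg g (List.mem_cons_of_mem _ h))
      (hR' hr₁) (R'.erase r₁) ((Finset.erase_subset _ _).trans hR') (Finset.notMem_erase _ _)
      (fun h => hx' (Finset.mem_of_mem_erase h))
      (by rw [Finset.card_erase_of_mem hr₁]; simp at hlen; omega) fun _ => hr₁x
    obtain ⟨u, z, v⟩ := g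
    refine ⟨w r₀ u + w u v + w v r₁ + c, ?_, fun T => ?_⟩
    · have h1 := hg (u, z, v) List.mem_cons_self r₀ hr₀ r₁ (hR' hr₁) hr₀₁
      convert K.add_mem h1 hc using 1
      dsimp only
      abel
    obtain ⟨l, hnd, -, hl, hw⟩ := hT T
    have hd := hdist (u, z, v) List.mem_cons_self
    have hgRm := hgR (u, z, v) List.mem_cons_self
    simp only [TripleDistinct] at hd
    obtain ⟨huz, hzv, huv⟩ := hd
    have hnR : ∀ y ∈ tripleSupport (u, z, v), y ∉ R := fun y hy hyR =>
      Finset.disjoint_left.1 hgRm hy hyR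
    have hu : u ∈ tripleSupport (u, z, v) := by simp [tripleSupport]
    have hz : z ∈ tripleSupport (u, z, v) := by simp [tripleSupport]
    have hv : v ∈ tripleSupport (u, z, v) := by simp [tripleSupport]
    have hnl : ∀ y ∈ tripleSupport (u, z, v), y ∉ r₁ :: l := by
      intro y hy hyl
      rcases List.mem_cons.1 hyl with rfl | hyl
      · exact hnR y hy (hR' hr₁)
      rcases hl y hyl with h | ⟨g, hg, hyg⟩
      · exact hnR y hy (hR' (Finset.mem_of_mem_erase h))
      · exact Finset.disjoint_left.1 (hdisj.1 g hg) hy hyg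
    have hr₀l : r₀ ∉ r₁ :: l := by
      intro hyl
      rcases List.mem_cons.1 hyl with h | hyl
      · exact hr₀₁ h
      rcases hl r₀ hyl with h | ⟨g, hg, hyg⟩
      · exact hr₀' (Finset.mem_of_mem_erase h)
      · exact Finset.disjoint_left.1 (hgR g (List.mem_cons_of_mem _ hg)) hyg hr₀
    have hr₀s : ∀ y ∈ tripleSupport (u, z, v), r₀ ≠ y := fun y hy h => hnR y hy (h ▸ hr₀)
    have hl' : ∀ y ∈ r₁ :: l, y ∈ R' ∨ ∃ g ∈ (u, z, v) :: gs, y ∈ tripleSupport g := by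
      intro y hy
      rcases List.mem_cons.1 hy with rfl | hy
      · exact Or.inl hr₁
      rcases hl y hy with h | ⟨g, hg, hyg⟩
      · exact Or.inl (Finset.mem_of_mem_erase h)
      · exact Or.inr ⟨g, List.mem_cons_of_mem _ hg, hyg⟩
    have hs : ∀ y ∈ tripleSupport (u, z, v), y ∈ R' ∨
        ∃ g ∈ (u, z, v) :: gs, y ∈ tripleSupport g :=
      fun y hy => Or.inr ⟨_, List.mem_cons_self, hy⟩
    by_cases hgT : (u, z, v) ∈ T
    · refine ⟨u :: z :: v :: r₁ :: l, ?_, by simp, ?_, ?_⟩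
      · have := hnl u hu
        have := hnl z hz
        have := hnl v hv
        have := hr₀s u hu
        have := hr₀s z hz
        have := hr₀s v hv
        simp only [List.nodup_cons, List.mem_cons] at *
        tauto
      · intro y hy
        rcases List.mem_cons.1 hy with rfl | hy
        · exact hs _ hu
        rcases List.mem_cons.1 hy with rfl | hy
        · exact hs _ hz
        rcases List.mem_cons.1 hy with rfl | hy
        · exact hs _ hv
        exact hl' y hy
      · simp only [walkWeight, hw, List.filter_cons, hgT, decide_true, if_true, List.map_cons,
          List.sum_cons, detour]
        abel
    · refine ⟨u :: v :: r₁ :: l, ?_, by simp, ?_, ?_⟩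
      · have := hnl u hu
        have := hnl v hv
        have := hr₀s u hu
        have := hr₀s v hv
        simp only [List.nodup_cons, List.mem_cons] at *
        tauto
      · intro y hy
        rcases List.mem_cons.1 hy with rfl | hy
        · exact hs _ hu
        rcases List.mem_cons.1 hy with rfl | hy
        · exact hs _ hv
        exact hl' y hy
      · simp only [walkWeight, hw, List.filter_cons, hgT, decide_false]
        simp only [Bool.false_eq_true, if_false]
        abel

theorem exists_zero_walk (w : V → V → Γ) (K : AddSubgroup Γ) (π : V → Γ) (R : Finset V)
    (hR : ∀ r ∈ R, ∀ r' ∈ R, r ≠ r' → w r r' - (π r' - π r) ∈ K)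
    (J : Finset (V × V × V))
    (hdisj : ∀ s ∈ J, ∀ t ∈ J, s ≠ t → Disjoint (tripleSupport s) (tripleSupport t))
    (hgR : ∀ g ∈ J, Disjoint (tripleSupport g) R) (hdist : ∀ g ∈ J, TripleDistinct g)
    (hg : ∀ g ∈ J, ∀ r ∈ R, ∀ r' ∈ R, r ≠ r' →
      w r g.1 + w g.1 g.2.2 + w g.2.2 r' - (π r' - π r) ∈ K)
    (hcard : J.card + 1 ≤ R.card) (hcard' : 2 ≤ R.card)
    (hK : ∀ y ∈ K, ∃ T ⊆ J, ∑ t ∈ T, detour w t = y) :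
    ∃ a l, l ≠ [] ∧ (a :: l).Nodup ∧ walkWeight w a a l = 0 := by
  obtain ⟨a, ha, b, hb, hab⟩ := Finset.one_lt_card.1 hcard'
  rcases J.eq_empty_or_nonempty with rfl | hJ
  · refine ⟨a, [b], by simp, by simpa using hab, ?_⟩
    have hmem : w a b + w b a ∈ K := by
      convert K.add_mem (hR a ha b hb hab) (hR b hb a ha hab.symm) using 1
      abel
    obtain ⟨T, hT, hy⟩ := hK _ hmem
    simp only [walkWeight, ← hy, Finset.subset_empty.1 hT, Finset.sum_empty]
  · obtain ⟨c, hc, hT⟩ := exists_walks w K π R hR ha J.toList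
      (J.nodup_toList.pairwise_of_forall_ne fun s hs t ht =>
        hdisj s (Finset.mem_toList.1 hs) t (Finset.mem_toList.1 ht))
      (fun g h => hgR g (Finset.mem_toList.1 h)) (fun g h => hdist g (Finset.mem_toList.1 h))
      (fun g h => hg g (Finset.mem_toList.1 h)) ha (R.erase a) (Finset.erase_subset _ _)
      (Finset.notMem_erase _ _) (Finset.notMem_erase _ _)
      (by rw [Finset.card_erase_of_mem ha, Finset.length_toList]; omega)
      (fun h => absurd (Finset.toList_eq_nil.1 h) hJ.ne_empty)
    rw [sub_self, sub_zero] at hc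
    obtain ⟨T, hTJ, hsum⟩ := hK _ (K.neg_mem hc)
    obtain ⟨l, hnd, hl, -, hw⟩ := hT T
    refine ⟨a, l, hl fun h => hJ.ne_empty (Finset.toList_eq_nil.1 h), hnd, ?_⟩
    have hfil : ((J.toList.filter (· ∈ T)).map (detour w)).sum = ∑ t ∈ T, detour w t := by
      have hnd' := J.nodup_toList.filter (· ∈ T)
      rw [← List.sum_toFinset _ hnd']
      refine Finset.sum_congr ?_ fun _ _ => rfl
      ext t
      simpa using fun h => hTJ h
    rw [hw, hfil, hsum, add_neg_cancel]

end Cycle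

section Families

open Module

variable {F V E : Type*} [Field F] [AddCommGroup E] [Module F E]

open Classical in
/-- The triples of a family whose detour lies in the subspace `L`. -/
noncomputable def triplesInside (w : V → V → E) (L : Submodule F E) (I : Finset (V × V × V)) :
    Finset (V × V × V) :=
  I.filter fun t => detour w t ∈ L

@[simp]
theorem mem_triplesInside {w : V → V → E} {L : Submodule F E} {I : Finset (V × V × V)}
    {t : V × V × V} : t ∈ triplesInside w L I ↔ t ∈ I ∧ detour w t ∈ L := by
  simp [triplesInside]

variable [DecidableEq V]

variable (F) in
/-- A family of disjoint triples of distinct vertices with at most `m * dim L` detours in every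
subspace `L`. -/
def IsSparseFamily (w : V → V → E) (m : ℕ) (I : Finset (V × V × V)) : Prop :=
  (∀ t ∈ I, TripleDistinct t) ∧
  (∀ s ∈ I, ∀ t ∈ I, s ≠ t → Disjoint (tripleSupport s) (tripleSupport t)) ∧
  ∀ L : Submodule F E, (triplesInside w L I).card ≤ m * finrank F L

/-- The subspace `L` contains as many detours of `I` as a sparse family can have. -/
def IsTightFor (w : V → V → E) (m : ℕ) (I : Finset (V × V × V)) (L : Submodule F E) : Prop :=
  (triplesInside w L I).card = m * finrank F L

variable {w : V → V → E} {m : ℕ} {I : Finset (V × V × V)}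

theorem card_triplesInside_add_le (A B : Submodule F E) :
    (triplesInside w A I).card + (triplesInside w B I).card ≤
      (triplesInside w (A ⊔ B) I).card + (triplesInside w (A ⊓ B) I).card := by
  rw [← Finset.card_union_add_card_inter]
  refine add_le_add (Finset.card_le_card fun t => ?_) (Finset.card_le_card fun t => ?_)
  · simp only [Finset.mem_union, mem_triplesInside]
    rintro (⟨h1, h2⟩ | ⟨h1, h2⟩)
    · exact ⟨h1, Submodule.mem_sup_left h2⟩
    · exact ⟨h1, Submodule.mem_sup_right h2⟩
  · simp only [Finset.mem_inter, mem_triplesInside, Submodule.mem_inf]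
    tauto

theorem IsSparseFamily.mono {J : Finset (V × V × V)} (hI : IsSparseFamily F w m I) (h : J ⊆ I) :
    IsSparseFamily F w m J := by
  refine ⟨fun t ht => hI.1 t (h ht), fun s hs t ht => hI.2.1 s (h hs) t (h ht), fun L => ?_⟩
  refine (Finset.card_le_card fun t => ?_).trans (hI.2.2 L)
  simp only [mem_triplesInside]
  exact fun ht => ⟨h ht.1, ht.2⟩

theorem isTightFor_bot (hI : IsSparseFamily F w m I) : IsTightFor w m I (⊥ : Submodule F E) := by
  have := hI.2.2 ⊥
  rw [finrank_bot, mul_zero] at this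
  rw [IsTightFor, finrank_bot, mul_zero]
  omega

theorem IsSparseFamily.of_subset_insert {I' : Finset (V × V × V)} {t : V × V × V}
    (hI : IsSparseFamily F w m I) (hsub : I' ⊆ insert t I) (ht : TripleDistinct t)
    (hdisj : ∀ s ∈ I', s ≠ t → Disjoint (tripleSupport s) (tripleSupport t))
    (htight : ∀ L : Submodule F E, IsTightFor w m I L → detour w t ∉ L) :
    IsSparseFamily F w m I' := by
  refine ⟨fun s hs => ?_, fun s hs s' hs' hne => ?_, fun L => ?_⟩
  · rcases Finset.mem_insert.1 (hsub hs) with rfl | h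
    exacts [ht, hI.1 s h]
  · by_cases h : s = t
    · subst h
      exact (hdisj s' hs' hne.symm).symm
    by_cases h' : s' = t
    · subst h'
      exact hdisj s hs hne
    exact hI.2.1 s (Finset.mem_of_mem_insert_of_ne (hsub hs) h) s'
      (Finset.mem_of_mem_insert_of_ne (hsub hs') h') hne
  · by_cases htL : detour w t ∈ L
    · have h1 : (triplesInside w L I).card < m * finrank F L :=
        lt_of_le_of_ne (hI.2.2 L) fun h => htight L h htL
      have h2 : triplesInside w L I' ⊆ insert t (triplesInside w L I) := by
        intro s hs
        rw [mem_triplesInside] at hs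
        rcases Finset.mem_insert.1 (hsub hs.1) with rfl | h
        · exact Finset.mem_insert_self _ _
        · exact Finset.mem_insert_of_mem (mem_triplesInside.2 ⟨h, hs.2⟩)
      have h3 := (Finset.card_le_card h2).trans (Finset.card_insert_le _ _)
      omega
    · refine (Finset.card_le_card fun s hs => ?_).trans (hI.2.2 L)
      rw [mem_triplesInside] at hs ⊢
      refine ⟨Finset.mem_of_mem_insert_of_ne (hsub hs.1) ?_, hs.2⟩
      rintro rfl
      exact htL hs.2

variable [Module.Finite F E]

theorem IsTightFor.sup (hI : IsSparseFamily F w m I) {A B : Submodule F E}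
    (hA : IsTightFor w m I A) (hB : IsTightFor w m I B) : IsTightFor w m I (A ⊔ B) := by
  have h1 := card_triplesInside_add_le (w := w) (I := I) A B
  have h2 := congrArg (m * ·) (Submodule.finrank_sup_add_finrank_inf_eq A B)
  have h3 := hI.2.2 (A ⊔ B)
  have h4 := hI.2.2 (A ⊓ B)
  simp only [mul_add] at h2
  rw [IsTightFor] at *
  omega

theorem exists_greatest_isTightFor (hI : IsSparseFamily F w m I) :
    ∃ L : Submodule F E, IsTightFor w m I L ∧ ∀ L', IsTightFor w m I L' → L' ≤ L := by
  obtain ⟨L, hL, hmax⟩ := (measure fun L : Submodule F E => finrank F E - finrank F L).wf.has_min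
    {L | IsTightFor w m I L} ⟨⊥, isTightFor_bot hI⟩
  refine ⟨L, hL, fun L' hL' => ?_⟩
  have h1 : ¬ finrank F E - finrank F ↥(L ⊔ L') < finrank F E - finrank F L :=
    hmax _ (hL.sup hI hL')
  have h2 : finrank F ↥(L ⊔ L') ≤ finrank F E := Submodule.finrank_le _
  have h3 : L = L ⊔ L' := Submodule.eq_of_le_of_finrank_le le_sup_left (by omega)
  rw [h3]
  exact le_sup_right

/-- `J` is a tight family for `K`, and every vector outside `K` avoids all tight subspaces of some
sparse family of size `k` off `R` whose triples inside `K` are those of `J`. -/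
def IsCore (w : V → V → E) (m k : ℕ) (K : Submodule F E) (J : Finset (V × V × V))
    (R : Finset V) : Prop :=
  J.card = m * finrank F K ∧ ∀ y ∉ K, ∃ I, IsSparseFamily F w m I ∧ I.card = k ∧
    (∀ t ∈ I, Disjoint (tripleSupport t) R) ∧ triplesInside w K I = J ∧
    ∀ L : Submodule F E, IsTightFor w m I L → y ∉ L

theorem IsCore.exists_smaller {k : ℕ} {K : Submodule F E} {J : Finset (V × V × V)} {R : Finset V}
    (h : IsCore w m k K J R) {g g' : V × V × V} (hg : g ∈ J) (hg' : TripleDistinct g')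
    {r r' : V} (hr : r ∈ R) (hr' : r' ∈ R) (hsupp : tripleSupport g' ⊆ tripleSupport g ∪ {r, r'})
    (hg'K : detour w g' ∉ K) :
    ∃ (K' : Submodule F E) (J' : Finset (V × V × V)), finrank F K' < finrank F K ∧
      IsCore w m k K' J' (R \ {r, r'}) := by
  obtain ⟨A, hA, hAk, hAR, rfl, hAtight⟩ := h.2 _ hg'K
  rw [mem_triplesInside] at hg
  obtain ⟨hgA, hgK⟩ := hg
  have hdisj : ∀ s ∈ A.erase g, Disjoint (tripleSupport s) (tripleSupport g') := by
    intro s hs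
    refine Disjoint.mono_right hsupp (Finset.disjoint_union_right.2 ⟨?_, ?_⟩)
    · exact hA.2.1 s (Finset.mem_of_mem_erase hs) g hgA (Finset.ne_of_mem_erase hs)
    · refine Disjoint.mono_right ?_ (hAR s (Finset.mem_of_mem_erase hs))
      simp [Finset.insert_subset_iff, hr, hr']
  have hg'A : g' ∉ A.erase g := by
    intro hmem
    have h1 : g'.1 ∈ tripleSupport g' := by simp [tripleSupport]
    exact Finset.disjoint_left.1 (hdisj g' hmem) h1 h1
  have hgg' : g ≠ g' := by
    rintro rfl
    exact hg'K hgK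
  set A' := insert g' (A.erase g) with hA'def
  have hA' : IsSparseFamily F w m A' := by
    refine hA.of_subset_insert (Finset.insert_subset_insert _ (Finset.erase_subset _ _)) hg' ?_
      hAtight
    intro s hs hne
    exact hdisj s (Finset.mem_of_mem_insert_of_ne hs hne)
  have hA'k : A'.card = k := by
    rw [hA'def, Finset.card_insert_of_notMem hg'A, Finset.card_erase_of_mem hgA, hAk]
    have := Finset.card_pos.2 ⟨g, hgA⟩
    omega
  obtain ⟨L, hL, hLmax⟩ := exists_greatest_isTightFor hA'
  have hgL : detour w g ∉ L := by
    intro hgL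
    have hmem : g ∈ triplesInside w L A := mem_triplesInside.2 ⟨hgA, hgL⟩
    have hpos := Finset.card_pos.2 ⟨g, hmem⟩
    have hAL := hA.2.2 L
    rw [IsTightFor] at hL
    by_cases hg'L : detour w g' ∈ L
    · refine hAtight L ?_ hg'L
      have hsub : triplesInside w L A' ⊆ insert g' ((triplesInside w L A).erase g) := by
        intro s hs
        simp only [hA'def, mem_triplesInside, Finset.mem_insert, Finset.mem_erase] at hs ⊢
        tauto
      have := (Finset.card_le_card hsub).trans (Finset.card_insert_le _ _)
      rw [Finset.card_erase_of_mem hmem] at this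
      rw [IsTightFor]
      omega
    · have hsub : triplesInside w L A' ⊆ (triplesInside w L A).erase g := by
        intro s hs
        simp only [hA'def, mem_triplesInside, Finset.mem_insert, Finset.mem_erase] at hs ⊢
        rcases hs with ⟨rfl | hs, hsL⟩
        · exact absurd hsL hg'L
        · tauto
      have := Finset.card_le_card hsub
      rw [Finset.card_erase_of_mem hmem] at this
      omega
  have hinside : triplesInside w (K ⊓ L) A' = triplesInside w (K ⊓ L) A := by
    ext s
    simp only [hA'def, mem_triplesInside, Finset.mem_insert, Finset.mem_erase, Submodule.mem_inf]
    constructor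
    · rintro ⟨rfl | hs, hsK, hsL⟩
      · exact absurd hsK hg'K
      · exact ⟨hs.2, hsK, hsL⟩
    · rintro ⟨hs, hsK, hsL⟩
      refine ⟨Or.inr ⟨?_, hs⟩, hsK, hsL⟩
      rintro rfl
      exact hgL hsL
  have hnest : ∀ I : Finset (V × V × V),
      triplesInside w (K ⊓ L) I = triplesInside w L (triplesInside w K I) := by
    intro I
    ext s
    simp only [mem_triplesInside, Submodule.mem_inf, and_assoc]
  refine ⟨K ⊓ L, triplesInside w L (triplesInside w K A), ?_, ?_, fun y hy => ?_⟩
  · refine Submodule.finrank_lt_finrank_of_lt (lt_of_le_of_ne inf_le_left fun h => hgL ?_)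
    rw [← h] at hgK
    exact hgK.2
  · rw [← hnest, ← hinside]
    refine le_antisymm (hA'.2.2 _) ?_
    by_contra hlt
    have hsub : (triplesInside w K A).erase g ⊆ triplesInside w K A' := by
      intro s hs
      simp only [hA'def, mem_triplesInside, Finset.mem_insert, Finset.mem_erase] at hs ⊢
      tauto
    have h1 := Finset.card_le_card hsub
    have hmem : g ∈ triplesInside w K A := mem_triplesInside.2 ⟨hgA, hgK⟩
    have hpos := Finset.card_pos.2 ⟨g, hmem⟩
    rw [Finset.card_erase_of_mem hmem, h.1] at h1
    rw [h.1] at hpos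
    have h2 := card_triplesInside_add_le (w := w) (I := A') K L
    have h3 := congrArg (m * ·) (Submodule.finrank_sup_add_finrank_inf_eq K L)
    simp only [mul_add] at h3
    have h4 := hA'.2.2 (K ⊔ L)
    have hL' := hL
    rw [IsTightFor] at hL'
    have h5 : IsTightFor w m A' (K ⊔ L) := by
      rw [IsTightFor]
      omega
    exact hgL (hLmax _ h5 (Submodule.mem_sup_left hgK))
  · by_cases hyK : y ∈ K
    · refine ⟨A', hA', hA'k, fun t ht => ?_, by rw [hinside, hnest], fun L' hL' hyL' => ?_⟩
      · by_cases htg : t = g'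
        · subst htg
          refine Disjoint.mono_left hsupp (Finset.disjoint_union_left.2 ⟨?_, ?_⟩)
          · exact (hAR g hgA).mono_right Finset.sdiff_subset
          · exact Finset.disjoint_sdiff
        · exact (hAR t (Finset.mem_of_mem_erase (Finset.mem_of_mem_insert_of_ne ht htg))).mono_right
            Finset.sdiff_subset
      · exact hy ⟨hyK, hLmax L' hL' hyL'⟩
    · obtain ⟨I, hI, hIk, hIR, hIK, hIt⟩ := h.2 y hyK
      exact ⟨I, hI, hIk, fun t ht => (hIR t ht).mono_right Finset.sdiff_subset,
        by rw [hnest, hIK], hIt⟩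

theorem IsCore.exists_zero_walk {n k : ℕ} (hm : 0 < m) (hn : 5 * finrank F E * m ≤ n)
    (hk : k < finrank F E * m) (hmax : ∀ I, IsSparseFamily F w m I → I.card ≤ k)
    (hcover : ∀ (K : Submodule F E) (J : Finset (V × V × V)), IsSparseFamily F w m J →
      J.card = m * finrank F K → (∀ t ∈ J, detour w t ∈ K) →
      ∀ y ∈ K, ∃ T ⊆ J, ∑ t ∈ T, detour w t = y)
    (K : Submodule F E) (J : Finset (V × V × V)) (R : Finset V) (h : IsCore w m k K J R)
    (hK : finrank F K < finrank F E)
    (hR : n + 2 + 2 * finrank F K ≤ R.card + 3 * k + 2 * finrank F E) :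
    ∃ a l, l ≠ [] ∧ (a :: l).Nodup ∧ walkWeight w a a l = 0 := by
  induction hd : finrank F K using Nat.strong_induction_on generalizing K J R with
  | _ N ih =>
  subst hd
  by_contra hno
  have hexch : ∀ g ∈ J, ∀ g', TripleDistinct g' → ∀ r ∈ R, ∀ r' ∈ R,
      tripleSupport g' ⊆ tripleSupport g ∪ {r, r'} → detour w g' ∈ K := by
    intro g hg g' hg' r hr r' hr' hsupp
    by_contra hg'K
    obtain ⟨K', J', hlt, hcore⟩ := h.exists_smaller hg hg' hr hr' hsupp hg'K
    refine hno (ih _ hlt K' J' _ hcore (hlt.trans hK) ?_ rfl)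
    have h1 := Finset.le_card_sdiff {r, r'} R
    have h2 : ({r, r'} : Finset V).card ≤ 2 := Finset.card_le_two
    omega
  have htriple : ∀ t, TripleDistinct t → tripleSupport t ⊆ R → detour w t ∈ K := by
    intro t ht hsupp
    by_contra htK
    obtain ⟨I, hI, hIk, hIR, -, hIt⟩ := h.2 _ htK
    have htI : t ∉ I := fun hmem => by
      have h1 : t.1 ∈ tripleSupport t := by simp [tripleSupport]
      exact Finset.disjoint_left.1 (hIR t hmem) h1 (hsupp h1)
    have h1 := hmax (insert t I) (hI.of_subset_insert subset_rfl ht (fun s hs hne =>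
      (hIR s (Finset.mem_of_mem_insert_of_ne hs hne)).mono_right hsupp) hIt)
    rw [Finset.card_insert_of_notMem htI] at h1
    omega
  have htop : K ≠ ⊤ := by
    rintro rfl
    simp at hK
  obtain ⟨y, -, hy⟩ := SetLike.exists_of_lt htop.lt_top
  obtain ⟨I, hI, -, hIR, rfl, -⟩ := h.2 y hy
  have hJI : triplesInside w K I ⊆ I := fun t ht => (mem_triplesInside.1 ht).1
  have hJ := hI.mono hJI
  have hcard : (triplesInside w K I).card + 3 ≤ R.card := by
    rw [h.1]
    obtain ⟨m, rfl⟩ := Nat.exists_eq_add_of_lt hm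
    obtain ⟨e, he⟩ := Nat.exists_eq_add_of_lt hK
    rw [he] at hn hk hR
    nlinarith [Nat.zero_le (finrank F K * m), Nat.zero_le (e * m)]
  have hback : ∀ r ∈ R, ∀ r' ∈ R, r ≠ r' → w r r' + w r' r ∈ K := by
    intro r hr r' hr' hne
    obtain ⟨s, hs, hsn⟩ := Finset.exists_mem_notMem_of_card_lt_card
      (s := {r, r'}) (t := R) (Finset.card_le_two.trans_lt (by omega))
    simp only [Finset.mem_insert, Finset.mem_singleton, not_or] at hsn
    convert K.add_mem
      (htriple (r, r', s) ⟨hne, Ne.symm hsn.2, Ne.symm hsn.1⟩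
        (by simp [tripleSupport, Finset.insert_subset_iff, hr, hr', hs]))
      (htriple (r', r, s) ⟨hne.symm, Ne.symm hsn.1, Ne.symm hsn.2⟩
        (by simp [tripleSupport, Finset.insert_subset_iff, hr, hr', hs])) using 1
    simp only [detour]
    abel
  obtain ⟨r₀, hr₀⟩ : R.Nonempty := Finset.card_pos.1 (by omega)
  have hpot : ∀ r ∈ R, ∀ r' ∈ R, r ≠ r' → w r r' -
      ((if r' = r₀ then 0 else w r₀ r') - (if r = r₀ then 0 else w r₀ r)) ∈ K.toAddSubgroup := by
    intro r hr r' hr' hne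
    rw [Submodule.mem_toAddSubgroup]
    by_cases h1 : r = r₀
    · subst h1
      simp [hne.symm]
    by_cases h2 : r' = r₀
    · subst h2
      simpa [h1] using hback r hr r' hr' hne
    convert htriple (r₀, r, r') ⟨Ne.symm h1, hne, Ne.symm h2⟩
      (by simp [tripleSupport, Finset.insert_subset_iff, hr, hr', hr₀]) using 1
    simp only [detour, h1, h2, if_false]
    abel
  refine hno (_root_.exists_zero_walk w K.toAddSubgroup (fun r => if r = r₀ then 0 else w r₀ r) R
    hpot (triplesInside w K I) hJ.2.1 (fun g hg => hIR g (hJI hg)) hJ.1 ?_ (by omega) (by omega)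
    (hcover K _ hJ h.1 fun t ht => (mem_triplesInside.1 ht).2))
  intro g hg r hr r' hr' hne
  rw [Submodule.mem_toAddSubgroup]
  have hgR : ∀ y ∈ tripleSupport g, ∀ r ∈ R, r ≠ y := fun y hy r hr hry =>
    Finset.disjoint_left.1 (hIR g (hJI hg)) hy (hry ▸ hr)
  have h1 : g.1 ∈ tripleSupport g := by simp [tripleSupport]
  have h2 : g.2.2 ∈ tripleSupport g := by simp [tripleSupport]
  convert K.add_mem (K.add_mem
    (hexch g hg (r, g.1, g.2.2) ⟨hgR _ h1 r hr, (hJ.1 g hg).2.2, hgR _ h2 r hr⟩ r hr r' hr'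
      (by simp [tripleSupport, Finset.insert_subset_iff]))
    (hexch g hg (r, g.2.2, r') ⟨hgR _ h2 r hr, (hgR _ h2 r' hr').symm, hne⟩ r hr r' hr'
      (by simp [tripleSupport, Finset.insert_subset_iff])))
    ((Submodule.mem_toAddSubgroup K).1 (hpot r hr r' hr' hne)) using 1
  simp only [detour]
  abel

theorem exists_zero_walk_of_card_ge [Fintype V] (hm : 0 < m) (hE : 0 < finrank F E)
    (w : V → V → E) (hV : 5 * finrank F E * m ≤ Fintype.card V)
    (hcover : ∀ (K : Submodule F E) (J : Finset (V × V × V)), IsSparseFamily F w m J →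
      J.card = m * finrank F K → (∀ t ∈ J, detour w t ∈ K) →
      ∀ y ∈ K, ∃ T ⊆ J, ∑ t ∈ T, detour w t = y) :
    ∃ a l, l ≠ [] ∧ (a :: l).Nodup ∧ walkWeight w a a l = 0 := by
  classical
  have htop : ∀ I, triplesInside w (⊤ : Submodule F E) I = I := fun I => by ext; simp
  obtain ⟨I, hI, hmax⟩ := Finset.exists_max_image
    (Finset.univ.filter fun I => IsSparseFamily F w m I) Finset.card
    ⟨∅, by simp [IsSparseFamily, triplesInside]⟩
  simp only [Finset.mem_filter, Finset.mem_univ, true_and] at hI hmax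
  have hIcard := hI.2.2 ⊤
  rw [htop, finrank_top] at hIcard
  set R : Finset V := (I.biUnion tripleSupport)ᶜ with hRdef
  have hRcard : Fintype.card V ≤ R.card + 3 * I.card := by
    have h1 : (I.biUnion tripleSupport).card ≤ I.card * 3 :=
      Finset.card_biUnion_le_card_mul _ _ _ fun t _ => Finset.card_le_three
    rw [hRdef, Finset.card_compl]
    omega
  have hIR : ∀ t ∈ I, Disjoint (tripleSupport t) R := fun t ht =>
    disjoint_compl_right.mono_left (Finset.subset_biUnion_of_mem tripleSupport ht)
  have hpos : 0 < finrank F E * m := Nat.mul_pos hE hm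
  have hcomm := mul_comm m (finrank F E)
  rw [mul_assoc] at hV
  by_cases hfull : I.card = m * finrank F E
  · exact exists_zero_walk w ⊤ (fun _ => 0) R (by simp) I hI.2.1 hIR hI.1 (by simp) (by omega)
      (by omega) fun y _ => hcover ⊤ I hI (by rw [hfull, finrank_top]) (by simp) y trivial
  · obtain ⟨K, hK, hKmax⟩ := exists_greatest_isTightFor hI
    have hKlt : finrank F K < finrank F E := by
      refine Submodule.finrank_lt fun h => hfull ?_
      rw [h, IsTightFor, htop, finrank_top] at hK
      exact hK
    refine IsCore.exists_zero_walk hm (mul_assoc 5 (finrank F E) m ▸ hV) (by omega) hmax hcover K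
      (triplesInside w K I) R
      ⟨hK, fun y hy => ⟨I, hI, rfl, hIR, rfl, fun L hL hyL => hy (hKmax L hL hyL)⟩⟩ hKlt ?_
    omega

end Families

/-- For every prime `p` and positive integer `d`, `n(ℤ_p^d) ≤ 5d·f(p,d)`: every
`(ℤ_p)^d`-labelling of the complete digraph on `5d·f(p,d)` vertices has a zero-sum cycle. -/
theorem zero_sum_cycle_of_card_ge_five_d_f (p d : ℕ) (hp : p.Prime) (hd : 0 < d)
    (w : Fin (5 * d * f p d) → Fin (5 * d * f p d) → (Fin d → ZMod p)) :
    HasZeroSumCycle w := by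
  classical
  have := Fact.mk hp
  have hdim : Module.finrank (ZMod p) (Fin d → ZMod p) = d := Module.finrank_fin_fun _
  obtain ⟨a, l, hl, hnd, hw⟩ := exists_zero_walk_of_card_ge (F := ZMod p) (f_pos hp d)
    (by rwa [hdim]) w (by rw [hdim, Fintype.card_fin]) (by
      intro K J hJ hcard hJK y hy
      obtain ⟨T, hT⟩ := exists_subset_sum_eq_of_tight (additiveBasisProp_f hp d)
        (fun t : J => detour w t) (fun L S hS => by
          refine le_trans ?_ (hJ.2.2 L)
          rw [← Finset.card_map (Function.Embedding.subtype (· ∈ J))]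
          refine Finset.card_le_card fun t ht => ?_
          obtain ⟨s, hs, rfl⟩ := Finset.mem_map.1 ht
          exact mem_triplesInside.2 ⟨s.2, hS s hs⟩) K (fun t => hJK t t.2)
        (by rw [Fintype.card_coe, hcard]) y hy
      refine ⟨T.map (Function.Embedding.subtype (· ∈ J)), fun t ht => ?_, ?_⟩
      · obtain ⟨s, -, rfl⟩ := Finset.mem_map.1 ht
        exact s.2
      · rw [Finset.sum_map]
        exact hT)
  exact hasZeroSumCycle_of_walkWeight w hl hnd hw
end

section
/- Let H be a (multi-)hypergraph, M a matroid, and γ: E(H) → E(M) a hyperedge-labelling. Let N be a maximal independent matching of size ℓ in (H,γ). Suppose there exists a hyperedge e ∈ E(H) such that γ(e) ∉ span(γ(N)). Then there exist an integer k > 0 and a collection X ⊆ E(H) of k+1 hyperedges such that H − V(X) contains a maximal independent matching of size ℓ − k and the subhypergraph of H formed by the hyperedges in X and their vertices is connected. -/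
/-- Given a (multi-)hypergraph with vertex type `V` and hyperedges indexed by `ι` via
`E : ι → Finset V`, a matroid `M` and a hyperedge-labelling `γ : ι → α`, a finset `N` of
hyperedges is an *independent matching* of the subhypergraph with available hyperedge set
`A` if its hyperedges lie in `A`, are pairwise vertex-disjoint, have pairwise distinct
labels, and their set of labels is independent in `M`. -/
def IsIndepMatching {V ι α : Type*} (E : ι → Finset V) (M : Matroid α) (γ : ι → α)
    (A : Set ι) (N : Finset ι) : Prop :=
  ↑N ⊆ A ∧
  (∀ e ∈ N, ∀ f ∈ N, e ≠ f → Disjoint (E e) (E f)) ∧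
  Set.InjOn γ ↑N ∧
  M.Indep (γ '' ↑N)

/-- An independent matching `N` (with available hyperedge set `A`) is *maximal* if there is
no independent matching `N'` with `span (γ(N')) = span (γ(N))` such that `N'` is not
inclusion-wise maximal. -/
def IsMaximalIndepMatching {V ι α : Type*} (E : ι → Finset V) (M : Matroid α) (γ : ι → α)
    (A : Set ι) (N : Finset ι) : Prop :=
  IsIndepMatching E M γ A N ∧
  ∀ N' : Finset ι, IsIndepMatching E M γ A N' →
    M.closure (γ '' ↑N') = M.closure (γ '' ↑N) →
    ∀ N'' : Finset ι, IsIndepMatching E M γ A N'' → ¬ N' ⊂ N''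

theorem isIndepMatching_iff_comap {V ι α : Type*} {E : ι → Finset V} {M : Matroid α} {γ : ι → α}
    {A : Set ι} {N : Finset ι} :
    IsIndepMatching E M γ A N ↔ ↑N ⊆ A ∧
      (∀ e ∈ N, ∀ f ∈ N, e ≠ f → Disjoint (E e) (E f)) ∧ (M.comap γ).Indep ↑N := by
  rw [IsIndepMatching, Matroid.comap_indep_iff]
  tauto

theorem closure_image_eq_iff_comap {ι α : Type*} {M : Matroid α} {γ : ι → α}
    (hγ : ∀ e, γ e ∈ M.E) {S T : Set ι} :
    M.closure (γ '' S) = M.closure (γ '' T) ↔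
      (M.comap γ).closure S = (M.comap γ).closure T := by
  have image_subset_ground (U : Set ι) : γ '' U ⊆ M.E := by
    rintro _ ⟨x, -, rfl⟩
    exact hγ x
  have closure_subset {U W : Set ι}
      (h : γ ⁻¹' M.closure (γ '' U) ⊆ γ ⁻¹' M.closure (γ '' W)) :
      M.closure (γ '' U) ⊆ M.closure (γ '' W) := by
    apply M.closure_subset_closure_of_subset_closure
    rintro _ ⟨x, hx, rfl⟩
    exact h (M.subset_closure _ (image_subset_ground U) ⟨x, hx, rfl⟩)
  rw [Matroid.comap_closure_eq, Matroid.comap_closure_eq]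
  exact ⟨fun h ↦ by rw [h], fun h ↦ (closure_subset h.le).antisymm (closure_subset h.ge)⟩

theorem Matroid.Indep.card_eq_of_closure_eq {α : Type*} {M : Matroid α} {I J : Finset α}
    (hI : M.Indep ↑I) (hJ : M.Indep ↑J) (h : M.closure ↑I = M.closure ↑J) :
    I.card = J.card := by
  have hb := hI.isBasis_closure
  rw [h] at hb
  simpa using hb.encard_eq_encard hJ.isBasis_closure

/-- A finite family of sets all of which meet a fixed member of the family is connected: every
bipartition of its union is crossed by a member. -/
theorem exists_mem_crossing_of_star {V ι : Type*} [DecidableEq V] {E : ι → Finset V}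
    {X : Finset ι} {e : ι} (he : e ∈ X) (hE : (E e).Nonempty)
    (hX : ∀ f ∈ X, ¬ Disjoint (E f) (E e)) {A : Finset V}
    (hAX : A ⊆ X.biUnion E) (hA : A.Nonempty) (hAc : (X.biUnion E \ A).Nonempty) :
    ∃ f ∈ X, (E f ∩ A).Nonempty ∧ (E f ∩ (X.biUnion E \ A)).Nonempty := by
  have subset_union {f : ι} (hf : f ∈ X) {v : V} (hv : v ∈ E f) : v ∈ X.biUnion E :=
    Finset.mem_biUnion.2 ⟨f, hf, hv⟩
  by_contra! hcon
  obtain ⟨v, hv⟩ := hE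
  by_cases hvA : v ∈ A
  · have he_sub : ∀ w ∈ E e, w ∈ A := by
      intro w hw
      by_contra hwA
      have := hcon e he ⟨v, by simp [hv, hvA]⟩
      have hw' : w ∈ E e ∩ (X.biUnion E \ A) := by
        simp [hw, hwA, -Finset.mem_biUnion, subset_union he hw]
      simp [this] at hw'
    obtain ⟨u, hu⟩ := hAc
    obtain ⟨huX, huA⟩ := Finset.mem_sdiff.1 hu
    obtain ⟨f, hf, huf⟩ := Finset.mem_biUnion.1 huX
    obtain ⟨w, hwf, hwe⟩ := Finset.not_disjoint_iff.1 (hX f hf)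
    have := hcon f hf ⟨w, Finset.mem_inter.2 ⟨hwf, he_sub w hwe⟩⟩
    have hu' := Finset.mem_inter.2 ⟨huf, hu⟩
    simp [this] at hu'
  · have he_disj : ∀ w ∈ E e, w ∉ A := by
      intro w hw hwA
      have := hcon e he ⟨w, by simp [hw, hwA]⟩
      have hv' : v ∈ E e ∩ (X.biUnion E \ A) := by
        simp [hv, hvA, -Finset.mem_biUnion, subset_union he hv]
      simp [this] at hv'
    obtain ⟨u, huA⟩ := hA
    obtain ⟨f, hf, huf⟩ := Finset.mem_biUnion.1 (hAX huA)
    obtain ⟨w, hwf, hwe⟩ := Finset.not_disjoint_iff.1 (hX f hf)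
    have := hcon f hf ⟨u, Finset.mem_inter.2 ⟨huf, huA⟩⟩
    have hw' : w ∈ E f ∩ (X.biUnion E \ A) := by
      simp [hwf, he_disj w hwe, -Finset.mem_biUnion, subset_union hf hwf]
    simp [this] at hw'

/-- Lemma 3.2: if `N` is a maximal independent matching of size `ℓ` in `(H, γ)` and there is
a hyperedge `e` with `γ e ∉ span (γ(N))`, then there are `k > 0` and a collection `X` of
`k + 1` hyperedges such that `H - V(X)` contains a maximal independent matching of size
`ℓ - k`, and the subhypergraph formed by the hyperedges of `X` and their vertices is
connected. -/
theorem exists_augmenting_structure {V ι α : Type*} [Fintype V] [DecidableEq V]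
    [DecidableEq ι] [Fintype ι]
    (E : ι → Finset V) (hE : ∀ e, (E e).Nonempty)
    (M : Matroid α) (γ : ι → α) (hγ : ∀ e, γ e ∈ M.E)
    (N : Finset ι) (ℓ : ℕ) (hN : IsMaximalIndepMatching E M γ Set.univ N)
    (hNcard : N.card = ℓ)
    (e : ι) (he : γ e ∉ M.closure (γ '' ↑N)) :
    ∃ (k : ℕ) (X : Finset ι), 0 < k ∧ X.card = k + 1 ∧
      (∃ N' : Finset ι,
        IsMaximalIndepMatching E M γ {e' | Disjoint (E e') (X.biUnion E)} N' ∧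
        N'.card = ℓ - k) ∧
      (∀ A : Finset V, A ⊆ X.biUnion E → A.Nonempty → (X.biUnion E \ A).Nonempty →
        ∃ e' ∈ X, (E e' ∩ A).Nonempty ∧ (E e' ∩ (X.biUnion E \ A)).Nonempty) := by
  classical
  subst hNcard
  simp only [IsMaximalIndepMatching, isIndepMatching_iff_comap,
    closure_image_eq_iff_comap hγ] at hN ⊢
  have he : e ∉ (M.comap γ).closure ↑N := by rwa [Matroid.comap_closure_eq]
  have hground : ∀ S : Set ι, S ⊆ (M.comap γ).E := fun S x _ ↦ hγ x
  generalize M.comap γ = L at *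
  obtain ⟨⟨-, hNdisj, hNind⟩, hNmax⟩ := hN
  have mem_closure_of_disjoint (I : Finset ι)
      (hdisj : ∀ a ∈ I, ∀ b ∈ I, a ≠ b → Disjoint (E a) (E b)) (hind : L.Indep ↑I)
      (hcl : L.closure ↑I = L.closure ↑N) (g : ι) (hg : ∀ a ∈ I, Disjoint (E g) (E a)) :
      g ∈ L.closure ↑N := by
    by_contra hgN
    rw [← hcl] at hgN
    have hgI : g ∉ I := fun h ↦ hgN (L.subset_closure _ (hground _) h)
    refine hNmax I ⟨Set.subset_univ _, hdisj, hind⟩ hcl (insert g I)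
      ⟨Set.subset_univ _, ?_, ?_⟩ (Finset.ssubset_insert hgI)
    · simp only [Finset.mem_insert]
      rintro a (rfl | ha) b (rfl | hb) hab
      · exact absurd rfl hab
      · exact hg b hb
      · exact (hg a ha).symm
      · exact hdisj a ha b hb hab
    · rw [Finset.coe_insert, hind.insert_indep_iff]
      exact Or.inl ⟨hground Set.univ trivial, hgN⟩
  obtain ⟨N₀, hN₀, hmin⟩ := Finset.exists_min_image
    (Finset.univ.filter fun I : Finset ι ↦
      (∀ a ∈ I, ∀ b ∈ I, a ≠ b → Disjoint (E a) (E b)) ∧ L.Indep ↑I ∧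
        L.closure ↑I = L.closure ↑N)
    (fun I ↦ (I.filter fun f ↦ ¬ Disjoint (E f) (E e)).card)
    ⟨N, by simpa using ⟨hNdisj, hNind⟩⟩
  simp only [Finset.mem_filter, Finset.mem_univ, true_and, and_imp] at hN₀ hmin
  obtain ⟨hdisj₀, hind₀, hcl₀⟩ := hN₀
  have hcard₀ := hind₀.card_eq_of_closure_eq hNind hcl₀
  set F := N₀.filter fun f ↦ ¬ Disjoint (E f) (E e) with hF
  have hFN : F ⊆ N₀ := Finset.filter_subset _ _
  have heF : e ∉ F := fun h ↦
    he (hcl₀ ▸ L.subset_closure _ (hground _) (Finset.mem_coe.2 (hFN h)))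
  have hsdiff : ∀ a ∈ N₀ \ F, Disjoint (E a) (E e) := by
    intro a ha
    simp only [hF, Finset.mem_sdiff, Finset.mem_filter, not_and, not_not] at ha
    exact ha.2 ha.1
  have mem_avail (a : ι) : Disjoint (E a) ((insert e F).biUnion E) ↔
      Disjoint (E a) (E e) ∧ ∀ f ∈ F, Disjoint (E a) (E f) := by
    simp [Finset.disjoint_biUnion_right]
  refine ⟨F.card, insert e F, ?_, Finset.card_insert_of_notMem heF, ⟨N₀ \ F,
    ⟨⟨?_, ?_, ?_⟩, ?_⟩, ?_⟩, ?_⟩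
  · rw [Finset.card_pos, Finset.nonempty_iff_ne_empty]
    intro hempty
    refine he (mem_closure_of_disjoint N₀ hdisj₀ hind₀ hcl₀ e fun a ha ↦ ?_)
    exact (hsdiff a (by simpa [hempty] using ha)).symm
  · intro a ha
    refine (mem_avail a).2 ⟨hsdiff a ha, fun f hf ↦ ?_⟩
    obtain ⟨haN, haF⟩ := Finset.mem_sdiff.1 (Finset.mem_coe.1 ha)
    exact hdisj₀ a haN f (hFN hf) fun h ↦ haF (h ▸ hf)
  · exact fun a ha b hb ↦ hdisj₀ a (Finset.mem_sdiff.1 ha).1 b (Finset.mem_sdiff.1 hb).1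
  · exact hind₀.subset (by simp)
  · rintro P ⟨-, -, hPind⟩ hPcl P' ⟨hP'av, hP'disj, hP'ind⟩ hPP'
    obtain ⟨g, hgP', hgP⟩ := Finset.exists_of_ssubset hPP'
    have hPsub := hPP'.1
    have avail (a : ι) (ha : a ∈ P') := (mem_avail a).1 (hP'av ha)
    have disjoint_of_mem (a : ι) (ha : a ∈ P' ∪ F) (b : ι) (hb : b ∈ P' ∪ F) (hab : a ≠ b) :
        Disjoint (E a) (E b) := by
      rcases Finset.mem_union.1 ha with ha | ha <;> rcases Finset.mem_union.1 hb with hb | hb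
      · exact hP'disj a ha b hb hab
      · exact (avail a ha).2 b hb
      · exact ((avail b hb).2 a ha).symm
      · exact hdisj₀ a (hFN ha) b (hFN hb) hab
    have hPF : L.closure (↑P ∪ ↑F) = L.closure ↑N := by
      rw [← L.closure_union_closure_left_eq, hPcl, L.closure_union_closure_left_eq, ← hcl₀,
        ← Finset.coe_union, Finset.sdiff_union_of_subset hFN]
    have exists_basis (Q : Finset ι) (hQ : Q ⊆ P') : ∃ I : Finset ι, Q ⊆ I ∧ I ⊆ Q ∪ F ∧
        L.Indep ↑I ∧ L.closure ↑I = L.closure (↑Q ∪ ↑F) := by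
      obtain ⟨I, hI, hQI⟩ := (hP'ind.subset (Finset.coe_subset.2 hQ)).subset_isBasis_of_subset
        (Set.subset_union_left (t := (F : Set ι))) (hground _)
      obtain ⟨I, rfl⟩ := I.toFinite.exists_finset_coe
      exact ⟨I, by exact_mod_cast hQI, by exact_mod_cast hI.subset, hI.indep,
        hI.closure_eq_closure⟩
    have subset_union {Q I : Finset ι} (hQ : Q ⊆ P') (hI : I ⊆ Q ∪ F) : I ⊆ P' ∪ F :=
      hI.trans (Finset.union_subset_union_left hQ)
    have hgN : g ∈ L.closure ↑N := by
      obtain ⟨I, -, hIsub, hIind, hIcl⟩ := exists_basis P hPsub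
      have hI := subset_union hPsub hIsub
      refine mem_closure_of_disjoint I (fun a ha b hb ↦ disjoint_of_mem a (hI ha) b (hI hb))
        hIind (hIcl.trans hPF) g fun a ha ↦ ?_
      rcases Finset.mem_union.1 (hIsub ha) with ha | ha
      · exact hP'disj g hgP' a (hPsub ha) fun h ↦ hgP (h ▸ ha)
      · exact (avail g hgP').2 a ha
    have hQ : insert g P ⊆ P' := Finset.insert_subset hgP' hPsub
    obtain ⟨I, hQI, hIsub, hIind, hIcl⟩ := exists_basis (insert g P) hQ
    have hIcl : L.closure ↑I = L.closure ↑N := by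
      rw [hIcl, Finset.coe_insert, Set.insert_union, ← hPF,
        L.closure_insert_eq_of_mem_closure (by rwa [hPF])]
    have hI := subset_union hQ hIsub
    have hfilter : (I.filter fun f ↦ ¬ Disjoint (E f) (E e)) ⊆ F := by
      intro a ha
      obtain ⟨haI, hae⟩ := Finset.mem_filter.1 ha
      exact (Finset.mem_union.1 (hI haI)).resolve_left fun h ↦ hae (avail a h).1
    have hFI : F ⊆ I := by
      rw [← Finset.eq_of_subset_of_card_le hfilter
        (hmin I (fun a ha b hb ↦ disjoint_of_mem a (hI ha) b (hI hb)) hIind hIcl)]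
      exact Finset.filter_subset _ _
    have hdisjF : Disjoint (insert g P) F := by
      rw [Finset.disjoint_left]
      intro a ha haF
      have := (avail a (hQ ha)).2 a haF
      exact (hE a).ne_empty (Finset.disjoint_self_iff_empty _ |>.1 this)
    have hle := Finset.card_le_card (Finset.union_subset hQI hFI)
    rw [Finset.card_union_of_disjoint hdisjF, Finset.card_insert_of_notMem hgP,
      hPind.card_eq_of_closure_eq (hind₀.subset (by simp)) hPcl,
      hIind.card_eq_of_closure_eq hind₀ (hIcl.trans hcl₀.symm)] at hle
    have := Finset.card_sdiff_add_card_eq_card hFN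
    omega
  · rw [Finset.card_sdiff_of_subset hFN, hcard₀]
  · intro A hAX hA hAc
    refine exists_mem_crossing_of_star (Finset.mem_insert_self e F) (hE e) ?_ hAX hA hAc
    intro f hf
    rcases Finset.mem_insert.1 hf with rfl | hf
    · simpa using (hE f).ne_empty
    · exact (Finset.mem_filter.1 hf).2
end

section
/- For every prime p and every positive integer d, n(Z_p^d) > (p−1)d; that is, there exists a labelling of the arcs of the complete digraph on (p−1)d vertices by elements of (Z_p)^d such that no directed cycle has arc-labels summing to zero. -/
/-- For every prime `p` and positive integer `d`, `n(ℤ_p^d) > (p-1)d`: there is a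
`(ℤ_p)^d`-labelling of the arcs of the complete digraph on `(p-1)d` vertices admitting
no zero-sum directed cycle. -/
theorem exists_labelling_no_zero_sum_cycle (p d : ℕ) (hp : p.Prime) (hd : 0 < d) :
    ∃ w : Fin ((p - 1) * d) → Fin ((p - 1) * d) → (Fin d → ZMod p),
      ¬ HasZeroSumCycle w := by
  -- Split the vertices into `d` classes of size `p - 1`; label arcs leaving class `j` by `e_j`.
  refine ⟨fun x _ => Pi.single (finProdFinEquiv.symm x).2 1, ?_⟩
  rintro ⟨ℓ, v, hv, hsum⟩
  set c : Fin (ℓ + 2) → Fin (p - 1) × Fin d := fun i => finProdFinEquiv.symm (v i) with hc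
  have hc_inj : Function.Injective c := finProdFinEquiv.symm.injective.comp hv
  set s := Finset.univ.filter fun i => (c 0).2 = (c i).2 with hs
  have hcard : (s.card : ZMod p) = 0 := by
    have h := congrFun hsum (c 0).2
    rw [Finset.sum_apply] at h
    simpa [Pi.single_apply, hs, hc] using h
  have hpos : 0 < s.card := Finset.card_pos.mpr ⟨0, by simp [hs]⟩
  have hle : s.card ≤ p - 1 := by
    refine (Finset.card_le_card_of_injOn (t := Finset.univ) (fun i => (c i).1) (by simp) ?_).trans
      (by simp)
    intro i hi j hj hij
    simp only [hs, Finset.coe_filter, Finset.mem_univ, true_and, Set.mem_ofPred_eq] at hi hj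
    exact hc_inj (Prod.ext hij (hi.symm.trans hj))
  have hdvd := Nat.le_of_dvd hpos ((ZMod.natCast_eq_zero_iff _ _).mp hcard)
  have := hp.pos
  omega
end
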